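/- For every odd integer r ≥ 5 there exists a constant c_r > 0 such that every finite simple graph with n ≥ 1 vertices and average degree d = 2e(G)/n that contains no cycle of length r has surplus at least c_r · n^(r/(r+1)) · d^((2r+1)/(2r+2)). -/

import Mathlib

namespace MaxCutPaper

variable {V : Type*}

/-- The size of the cut induced by a vertex subset `S`: the number of edges of `G`
with one endpoint in `S` and the other outside `S` (counted via ordered pairs with
first coordinate in `S`). -/
noncomputable def cutSize [Fintype V] (G : SimpleGraph V) (S : Finset V) : ℕ :=
  Nat.card {p : V × V // p.1 ∈ S ∧ p.2 ∉ S ∧ G.Adj p.1 p.2}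

/-- The maximum size of a cut of `G`. -/
noncomputable def maxCut [Fintype V] (G : SimpleGraph V) : ℕ :=
  (Finset.univ : Finset V).powerset.sup (cutSize G)

/-- The number of edges of `G`. -/
noncomputable def edgeCount (G : SimpleGraph V) : ℕ := Nat.card G.edgeSet

/-- The surplus of `G`: `mc(G) - e(G)/2`. -/
noncomputable def surplus [Fintype V] (G : SimpleGraph V) : ℝ :=
  (maxCut G : ℝ) - (edgeCount G : ℝ) / 2

/-- The degree of a vertex. -/
noncomputable def degC (G : SimpleGraph V) (v : V) : ℕ := Nat.card (G.neighborSet v)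

/-- The number of copies of `K_r` in `G`, i.e. `r`-element sets of pairwise adjacent
vertices. -/
noncomputable def cliqueCount (G : SimpleGraph V) (r : ℕ) : ℕ :=
  Nat.card {s : Finset V // G.IsNClique r s}

/-- `G` contains no cycle of length `r`. -/
def CycleFree (G : SimpleGraph V) (r : ℕ) : Prop :=
  ∀ ⦃v : V⦄ (w : G.Walk v v), w.IsCycle → w.length ≠ r

/-- `G` is `d`-degenerate (for a real `d ≥ 0`): every (induced) subgraph has a vertex of
degree at most `d`. -/
def Degenerate (G : SimpleGraph V) (d : ℝ) : Prop :=
  ∀ B : Finset V, B.Nonempty → ∃ v ∈ B, (Nat.card {u : V // u ∈ B ∧ G.Adj v u} : ℝ) ≤ d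

/-- The number of edges of `G` with both endpoints in `T`. -/
noncomputable def edgesIn (G : SimpleGraph V) (T : Finset V) : ℝ :=
  (Nat.card {p : V × V // p.1 ∈ T ∧ p.2 ∈ T ∧ G.Adj p.1 p.2} : ℝ) / 2

theorem exists_spectral_decomposition [Fintype V] [DecidableEq V] {B : Matrix V V ℝ}
    (hB : B.PosSemidef) :
    ∃ (l : V → ℝ) (U : V → V → ℝ), (∀ i, 0 ≤ l i) ∧
      (∀ k u v, (B ^ k) u v = ∑ i, U u i * U v i * l i ^ k) ∧ (∀ i, ∑ u, U u i * U u i = 1) := by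
  have hH := hB.isHermitian
  refine ⟨hH.eigenvalues, fun u i => (hH.eigenvectorUnitary : Matrix V V ℝ) u i,
    fun i => hB.eigenvalues_nonneg i, fun k u v => ?_, fun i => ?_⟩
  · have h := hH.spectral_theorem
    have h2 : B ^ k = Unitary.conjStarAlgAut ℝ _ hH.eigenvectorUnitary
        (Matrix.diagonal (fun i => hH.eigenvalues i ^ k)) := by
      conv_lhs => rw [h]
      rw [← map_pow, Matrix.diagonal_pow]
      rfl
    rw [h2, Unitary.conjStarAlgAut_apply, Matrix.mul_apply]
    refine Finset.sum_congr rfl fun i _ => ?_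
    rw [Matrix.mul_diagonal]
    simp [Matrix.star_apply]
    ring
  · have h : star (hH.eigenvectorUnitary : Matrix V V ℝ) * hH.eigenvectorUnitary = 1 :=
      Unitary.coe_star_mul_self _
    have h1 := congrFun (congrFun h i) i
    simpa [Matrix.mul_apply, Matrix.star_apply] using h1

theorem moment_mul_moment_le {ι : Type*} [Fintype ι] (c l : ι → ℝ) (hc : ∀ i, 0 ≤ c i)
    (hl : ∀ i, 0 ≤ l i) (p q : ℕ) :
    (∑ i, c i * l i ^ (p + 1)) * (∑ i, c i * l i ^ (q + 1)) ≤
      (∑ i, c i * l i ^ 1) * (∑ i, c i * l i ^ (p + q + 1)) := by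
  have key : ∀ i j, c i * l i ^ (p + 1) * (c j * l j ^ (q + 1)) +
      c j * l j ^ (p + 1) * (c i * l i ^ (q + 1)) ≤
      c i * l i ^ 1 * (c j * l j ^ (p + q + 1)) + c j * l j ^ 1 * (c i * l i ^ (p + q + 1)) := by
    intro i j
    have h : 0 ≤ (l i ^ p - l j ^ p) * (l i ^ q - l j ^ q) := by
      rcases le_total (l i) (l j) with h | h
      · exact mul_nonneg_of_nonpos_of_nonpos
          (sub_nonpos.2 (pow_le_pow_left₀ (hl i) h p)) (sub_nonpos.2 (pow_le_pow_left₀ (hl i) h q))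
      · exact mul_nonneg
          (sub_nonneg.2 (pow_le_pow_left₀ (hl j) h p)) (sub_nonneg.2 (pow_le_pow_left₀ (hl j) h q))
    have h2 := mul_nonneg (mul_nonneg (mul_nonneg (hc i) (hc j)) (mul_nonneg (hl i) (hl j))) h
    ring_nf at h2 ⊢
    linarith
  have h1 := Finset.sum_le_sum fun i (_ : i ∈ Finset.univ) =>
    Finset.sum_le_sum fun j (_ : j ∈ Finset.univ) => key i j
  simp only [Finset.sum_add_distrib] at h1
  rw [Finset.sum_comm (f := fun i j => c j * l j ^ (p + 1) * (c i * l i ^ (q + 1))),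
    Finset.sum_comm (f := fun i j => c j * l j ^ 1 * (c i * l i ^ (p + q + 1)))] at h1
  simp only [Finset.sum_mul_sum]
  linarith

theorem diag_pow_mul_diag_pow_le [Fintype V] [DecidableEq V] {B : Matrix V V ℝ}
    (hB : B.PosSemidef) (v : V) (p q : ℕ) :
    (B ^ (p + 1)) v v * (B ^ (q + 1)) v v ≤ B v v * (B ^ (p + q + 1)) v v := by
  obtain ⟨l, U, hl, hU, -⟩ := exists_spectral_decomposition hB
  have h := moment_mul_moment_le (fun i => U v i * U v i) l (fun i => mul_self_nonneg _) hl p q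
  simp only [← hU] at h
  rwa [pow_one B] at h

/-- The total `B`-weight of walks with `k` steps from `s` to `t` which are self-avoiding
and avoid the vertices in `L`. -/
noncomputable def pathSum [Fintype V] (B : Matrix V V ℝ) : ℕ → Set V → V → V → ℝ
  | 0, L, s, t => by classical exact if s ∉ L ∧ s = t then 1 else 0
  | k + 1, L, s, t => by
      classical exact if s ∉ L then ∑ u, B s u * pathSum B k (insert s L) u t else 0

theorem exists_path_of_pathSum_ne_zero [Fintype V] (G : SimpleGraph V) {B : Matrix V V ℝ}
    (P : V → Prop) (hG : ∀ u v, B u v ≠ 0 → (u = v ∨ G.Adj u v) ∧ P v) (k : ℕ) (L : Set V) (s t : V)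
    (h : pathSum B k L s t ≠ 0) :
    ∃ w : G.Walk s t, w.IsPath ∧ w.length = k ∧ ∀ x ∈ w.support, x ∉ L ∧ (x = s ∨ P x) := by
  induction k generalizing L s with
  | zero =>
    simp only [pathSum, ne_eq, ite_eq_right_iff, one_ne_zero, imp_false, not_not] at h
    obtain ⟨h1, rfl⟩ := h
    exact ⟨.nil, by simp, rfl, by simpa⟩
  | succ k ih =>
    by_cases hs : s ∈ L
    · simp [pathSum, hs] at h
    · simp only [pathSum, hs, not_false_eq_true, if_true] at h
      obtain ⟨u, -, hu⟩ := Finset.exists_ne_zero_of_sum_ne_zero h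
      obtain ⟨w, hw, hlen, hsup⟩ := ih _ _ (right_ne_zero_of_mul hu)
      have hsw : s ∉ w.support := fun hx => (hsup s hx).1 (Set.mem_insert _ _)
      obtain ⟨hadj, hPu⟩ := hG s u (left_ne_zero_of_mul hu)
      rcases hadj with rfl | hadj
      · exact absurd w.start_mem_support hsw
      · refine ⟨.cons hadj w, hw.cons hsw, by simp [hlen], ?_⟩
        intro x hx
        rw [SimpleGraph.Walk.support_cons, List.mem_cons] at hx
        rcases hx with rfl | hx
        · exact ⟨hs, Or.inl rfl⟩
        · refine ⟨fun h => (hsup x hx).1 (Set.mem_insert_of_mem _ h), Or.inr ?_⟩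
          rcases (hsup x hx).2 with rfl | h
          · exact hPu
          · exact h

theorem pow_apply_nonneg [Fintype V] [DecidableEq V] {B : Matrix V V ℝ} (hB : ∀ u v, 0 ≤ B u v)
    (k : ℕ) (u v : V) : 0 ≤ (B ^ k) u v := by
  induction k generalizing u with
  | zero => simp only [pow_zero, Matrix.one_apply]; split_ifs <;> norm_num
  | succ k ih =>
    rw [pow_succ', Matrix.mul_apply]
    exact Finset.sum_nonneg fun w _ => mul_nonneg (hB _ _) (ih _)

/-- The total weight of walks from `s` to `t` with `k` steps and a marked repeated vertex. -/
noncomputable def loopSum [Fintype V] [DecidableEq V] (B : Matrix V V ℝ) (k : ℕ) (s t : V) : ℝ :=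
  ∑ i ∈ Finset.range k, ∑ j ∈ Finset.range (k - i), ∑ v,
    (B ^ i) s v * (B ^ (j + 1)) v v * (B ^ (k - i - 1 - j)) v t

theorem loopSum_succ [Fintype V] [DecidableEq V] (B : Matrix V V ℝ) (k : ℕ) (s t : V) :
    loopSum B (k + 1) s t = ∑ j ∈ Finset.range (k + 1), (B ^ (j + 1)) s s * (B ^ (k - j)) s t +
      ∑ u, B s u * loopSum B k u t := by
  unfold loopSum
  rw [Finset.sum_range_succ', add_comm]
  congr 1
  · simp [Matrix.one_apply]
  · simp only [Finset.mul_sum]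
    symm
    rw [Finset.sum_comm]
    refine Finset.sum_congr rfl fun i _ => ?_
    rw [Finset.sum_comm]
    have e : k + 1 - (i + 1) = k - i := by omega
    rw [e]
    refine Finset.sum_congr rfl fun j _ => ?_
    rw [Finset.sum_comm]
    refine Finset.sum_congr rfl fun v _ => ?_
    rw [pow_succ' B i, Matrix.mul_apply, Finset.sum_mul, Finset.sum_mul]
    exact Finset.sum_congr rfl fun u _ => by ring

theorem pow_apply_le_pathSum_add [Fintype V] [DecidableEq V] {B : Matrix V V ℝ}
    (hB : ∀ u v, 0 ≤ B u v) (k : ℕ) (L : Finset V) (s t : V) :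
    (B ^ k) s t ≤ pathSum B k L s t +
      ∑ w ∈ L, ∑ j ∈ Finset.range (k + 1), (B ^ j) s w * (B ^ (k - j)) w t + loopSum B k s t := by
  have hP := pow_apply_nonneg hB
  have hloop : ∀ k s, 0 ≤ loopSum B k s t := fun k s =>
    Finset.sum_nonneg fun i _ => Finset.sum_nonneg fun j _ => Finset.sum_nonneg fun v _ =>
      mul_nonneg (mul_nonneg (hP _ _ _) (hP _ _ _)) (hP _ _ _)
  induction k generalizing L s with
  | zero =>
    by_cases hs : s ∈ L
    · have h1 : (B ^ 0) s t ≤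
          ∑ w ∈ L, ∑ j ∈ Finset.range (0 + 1), (B ^ j) s w * (B ^ (0 - j)) w t := by
        have := Finset.single_le_sum (f := fun w => ∑ j ∈ Finset.range (0 + 1),
          (B ^ j) s w * (B ^ (0 - j)) w t) (fun w _ => Finset.sum_nonneg fun j _ =>
          mul_nonneg (hP _ _ _) (hP _ _ _)) hs
        simpa using this
      have := hloop 0 s
      simp only [pathSum, Finset.mem_coe, hs, not_true_eq_false, false_and, if_false]
      linarith
    · have h2 : 0 ≤ ∑ w ∈ L, ∑ j ∈ Finset.range (0 + 1), (B ^ j) s w * (B ^ (0 - j)) w t :=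
        Finset.sum_nonneg fun w _ => Finset.sum_nonneg fun j _ =>
          mul_nonneg (hP _ _ _) (hP _ _ _)
      have := hloop 0 s
      have e : pathSum B 0 L s t = (B ^ 0) s t := by simp [pathSum, hs, Matrix.one_apply]
      linarith
  | succ k ih =>
    by_cases hs : s ∈ L
    · have h1 : (B ^ (k + 1)) s t ≤
          ∑ w ∈ L, ∑ j ∈ Finset.range (k + 1 + 1), (B ^ j) s w * (B ^ (k + 1 - j)) w t := by
        have h2 := Finset.single_le_sum (f := fun w => ∑ j ∈ Finset.range (k + 1 + 1),
          (B ^ j) s w * (B ^ (k + 1 - j)) w t) (fun w _ => Finset.sum_nonneg fun j _ =>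
          mul_nonneg (hP _ _ _) (hP _ _ _)) hs
        have h3 := Finset.single_le_sum (f := fun j => (B ^ j) s s * (B ^ (k + 1 - j)) s t)
          (fun j _ => mul_nonneg (hP _ _ _) (hP _ _ _)) (Finset.mem_range.2 (Nat.succ_pos (k + 1)))
        simp only [pow_zero, Matrix.one_apply_eq, one_mul, Nat.sub_zero] at h3
        exact h3.trans h2
      have := hloop (k + 1) s
      have e : pathSum B (k + 1) L s t = 0 := by simp [pathSum, hs]
      linarith
    · have h1 : (B ^ (k + 1)) s t ≤ ∑ u, B s u * (pathSum B k (insert s (L : Set V)) u t +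
          ∑ w ∈ insert s L, ∑ j ∈ Finset.range (k + 1), (B ^ j) u w * (B ^ (k - j)) w t +
            loopSum B k u t) := by
        rw [pow_succ', Matrix.mul_apply]
        refine Finset.sum_le_sum fun u _ => mul_le_mul_of_nonneg_left ?_ (hB _ _)
        have := ih (insert s L) u
        rwa [Finset.coe_insert] at this
      simp only [mul_add, Finset.sum_add_distrib] at h1
      have e : pathSum B (k + 1) L s t =
          ∑ u, B s u * pathSum B k (insert s (L : Set V)) u t := by simp [pathSum, hs]
      have h2 : ∑ u, B s u * ∑ w ∈ insert s L, ∑ j ∈ Finset.range (k + 1),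
          (B ^ j) u w * (B ^ (k - j)) w t =
          ∑ w ∈ insert s L, ∑ j ∈ Finset.range (k + 1),
            (B ^ (j + 1)) s w * (B ^ (k - j)) w t := by
        simp only [Finset.mul_sum]
        rw [Finset.sum_comm]
        refine Finset.sum_congr rfl fun w _ => ?_
        rw [Finset.sum_comm]
        refine Finset.sum_congr rfl fun j _ => ?_
        rw [pow_succ', Matrix.mul_apply, Finset.sum_mul]
        exact Finset.sum_congr rfl fun u _ => by ring
      rw [h2, Finset.sum_insert hs] at h1
      have h3 : ∑ w ∈ L, ∑ j ∈ Finset.range (k + 1), (B ^ (j + 1)) s w * (B ^ (k - j)) w t ≤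
          ∑ w ∈ L, ∑ j ∈ Finset.range (k + 1 + 1), (B ^ j) s w * (B ^ (k + 1 - j)) w t := by
        refine Finset.sum_le_sum fun w _ => ?_
        rw [Finset.sum_range_succ' _ (k + 1)]
        simp only [Nat.add_sub_add_right]
        have := mul_nonneg (hP 0 s w) (hP (k + 1 - 0) w t)
        linarith
      rw [e, loopSum_succ]
      linarith

theorem sum_mul_pow_apply_mul_eq [Fintype V] [DecidableEq V] {B : Matrix V V ℝ} {l : V → ℝ}
    {U : V → V → ℝ} (hU : ∀ k u v, (B ^ k) u v = ∑ i, U u i * U v i * l i ^ k) (k : ℕ)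
    (x : V → ℝ) :
    ∑ u, ∑ v, x u * (B ^ k) u v * x v = ∑ i, (∑ u, U u i * x u) ^ 2 * l i ^ k := by
  have h : ∀ i, (∑ u, U u i * x u) ^ 2 * l i ^ k =
      ∑ u, ∑ v, x u * (U u i * U v i * l i ^ k) * x v := by
    intro i
    rw [sq, Finset.sum_mul_sum, Finset.sum_mul]
    refine Finset.sum_congr rfl fun u _ => ?_
    rw [Finset.sum_mul]
    exact Finset.sum_congr rfl fun v _ => by ring
  simp only [h, hU, Finset.mul_sum, Finset.sum_mul]
  symm
  rw [Finset.sum_comm]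
  refine Finset.sum_congr rfl fun u _ => ?_
  rw [Finset.sum_comm]

theorem sum_mul_pow_apply_mul_le [Fintype V] [DecidableEq V] {B : Matrix V V ℝ} {l : V → ℝ}
    {U : V → V → ℝ} (hU : ∀ k u v, (B ^ k) u v = ∑ i, U u i * U v i * l i ^ k)
    (hl : ∀ i, 0 ≤ l i) {c : ℝ} (hc : ∀ i, l i ≤ c) (k : ℕ) (x : V → ℝ) :
    ∑ u, ∑ v, x u * (B ^ k) u v * x v ≤ c ^ k * ∑ u, x u ^ 2 := by
  have h0 := sum_mul_pow_apply_mul_eq hU 0 x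
  simp only [pow_zero, mul_one, Matrix.one_apply, mul_ite, ite_mul, mul_zero, zero_mul,
    Finset.sum_ite_eq, Finset.mem_univ, if_true, ← sq] at h0
  rw [sum_mul_pow_apply_mul_eq hU, h0, Finset.mul_sum]
  refine Finset.sum_le_sum fun i _ => ?_
  rw [mul_comm]
  exact mul_le_mul_of_nonneg_right (pow_le_pow_left₀ (hl i) (hc i) k) (sq_nonneg _)

theorem sum_sum_sum_comm {ι : Type*} [Fintype V] (A : Finset ι) (f : V → V → ι → ℝ) :
    ∑ s, ∑ t, ∑ i ∈ A, f s t i = ∑ i ∈ A, ∑ s, ∑ t, f s t i :=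
  (Finset.sum_congr rfl fun _ _ => Finset.sum_comm).trans Finset.sum_comm

theorem sum_mul_loopSum {F : V → V → ℝ} [Fintype V] [DecidableEq V] (B : Matrix V V ℝ) (k : ℕ) :
    ∑ s, ∑ t, F s t * loopSum B k s t = ∑ i ∈ Finset.range k, ∑ j ∈ Finset.range (k - i), ∑ v,
      (B ^ (j + 1)) v v * ∑ s, ∑ t, F s t * ((B ^ i) s v * (B ^ (k - i - 1 - j)) v t) := by
  unfold loopSum
  simp only [Finset.mul_sum]
  rw [sum_sum_sum_comm]
  refine Finset.sum_congr rfl fun i _ => ?_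
  rw [sum_sum_sum_comm]
  refine Finset.sum_congr rfl fun j _ => ?_
  rw [sum_sum_sum_comm]
  exact Finset.sum_congr rfl fun v _ => Finset.sum_congr rfl fun s _ =>
    Finset.sum_congr rfl fun t _ => by ring

theorem trace_pow_succ_le [Fintype V] [DecidableEq V] {B : Matrix V V ℝ} (hB : B.PosSemidef)
    (h0 : ∀ u v, 0 ≤ B u v) (h1 : ∀ v, B v v ≤ 1) (k : ℕ)
    (hk : ∀ s t, B t s * pathSum B k ∅ s t = 0) :
    ∑ v, (B ^ (k + 1)) v v ≤ k ^ 2 * ∑ v, (B ^ k) v v := by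
  have hP := pow_apply_nonneg h0
  have h2 : ∑ v, (B ^ (k + 1)) v v ≤ ∑ s, ∑ t, B t s * loopSum B k s t := by
    refine Finset.sum_le_sum fun s _ => ?_
    rw [pow_succ, Matrix.mul_apply]
    refine Finset.sum_le_sum fun t _ => ?_
    have h := pow_apply_le_pathSum_add h0 k ∅ s t
    simp only [Finset.coe_empty, Finset.sum_empty, add_zero] at h
    have := mul_le_mul_of_nonneg_left h (h0 t s)
    rw [mul_add, hk, zero_add] at this
    linarith
  rw [sum_mul_loopSum] at h2
  refine h2.trans ?_
  have h3 : ∀ i ∈ Finset.range k, ∑ j ∈ Finset.range (k - i), ∑ v,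
      (B ^ (j + 1)) v v * ∑ s, ∑ t, B t s * ((B ^ i) s v * (B ^ (k - i - 1 - j)) v t) ≤
      k * ∑ v, (B ^ k) v v := by
    intro i hi
    have h4 : ∀ j ∈ Finset.range (k - i), ∑ v, (B ^ (j + 1)) v v *
        ∑ s, ∑ t, B t s * ((B ^ i) s v * (B ^ (k - i - 1 - j)) v t) ≤ ∑ v, (B ^ k) v v := by
      intro j hj
      rw [Finset.mem_range] at hi hj
      refine Finset.sum_le_sum fun v _ => ?_
      have h5 : ∑ s, ∑ t, B t s * ((B ^ i) s v * (B ^ (k - i - 1 - j)) v t) =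
          (B ^ ((k - 1 - j) + 1)) v v := by
        have e : k - 1 - j + 1 = (k - i - 1 - j) + (1 + i) := by omega
        rw [e, pow_add, Matrix.mul_apply, Finset.sum_comm]
        refine Finset.sum_congr rfl fun t _ => ?_
        rw [pow_add, Matrix.mul_apply, Finset.mul_sum, pow_one]
        exact Finset.sum_congr rfl fun s _ => by ring
      rw [h5]
      refine (diag_pow_mul_diag_pow_le hB v j (k - 1 - j)).trans ?_
      have e : j + (k - 1 - j) + 1 = k := by omega
      rw [e]
      exact mul_le_of_le_one_left (hP _ _ _) (h1 v)
    refine (Finset.sum_le_sum h4).trans ?_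
    rw [Finset.sum_const, Finset.card_range, nsmul_eq_mul]
    refine mul_le_mul_of_nonneg_right ?_ (Finset.sum_nonneg fun v _ => hP _ _ _)
    exact_mod_cast Nat.sub_le k i
  refine (Finset.sum_le_sum h3).trans ?_
  rw [Finset.sum_const, Finset.card_range, nsmul_eq_mul]
  exact le_of_eq (by ring)

/-- A trace bound for the quadratic form of a positive semidefinite matrix whose support graph
has no closed self-avoiding walk with `k + 1` steps. -/
theorem quadratic_form_le_of_trace [Fintype V] [DecidableEq V] {B : Matrix V V ℝ}
    (hB : B.PosSemidef) (h0 : ∀ u v, 0 ≤ B u v) (h1 : ∀ v, B v v ≤ 1) (k : ℕ) (hk0 : 1 ≤ k)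
    (hk : ∀ s t, B t s * pathSum B k ∅ s t = 0) {c : ℝ} (hc0 : 0 ≤ c)
    (hc : 2 * (2 * (k : ℝ) ^ 2) ^ k * ∑ v, B v v ≤ c ^ (k + 1)) (x : V → ℝ) :
    ∑ u, ∑ v, x u * B u v * x v ≤ c * ∑ u, x u ^ 2 := by
  obtain ⟨l, U, hl, hU, hUn⟩ := exists_spectral_decomposition hB
  have htr : ∀ j, ∑ v, (B ^ j) v v = ∑ i, l i ^ j := by
    intro j
    simp only [hU]
    rw [Finset.sum_comm]
    simp only [← Finset.sum_mul, hUn, one_mul]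
  have h2 := trace_pow_succ_le hB h0 h1 k hk
  have h3 := htr 1
  simp only [pow_one] at h3
  rw [htr, htr] at h2
  have hk1 : (1 : ℝ) ≤ k := by exact_mod_cast hk0
  have h4 : ∀ i, (k : ℝ) ^ 2 * l i ^ k ≤ l i ^ (k + 1) / 2 + (2 * (k : ℝ) ^ 2) ^ k * l i := by
    intro i
    have hli := hl i
    rcases le_total (l i) (2 * (k : ℝ) ^ 2) with h | h
    · obtain ⟨q, rfl⟩ : ∃ q, k = q + 1 := ⟨k - 1, by omega⟩
      set C : ℝ := ((q + 1 : ℕ) : ℝ) ^ 2 with hC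
      have hC0 : 0 ≤ C := by positivity
      have h5 : l i ^ q ≤ (2 * C) ^ q := pow_le_pow_left₀ hli h q
      have h6 : C * l i ^ (q + 1) ≤ (2 * C) ^ (q + 1) * l i := by
        have h7 : C * l i ^ q ≤ 2 * C * (2 * C) ^ q :=
          mul_le_mul (by linarith) h5 (by positivity) (by positivity)
        calc C * l i ^ (q + 1) = C * l i ^ q * l i := by ring
          _ ≤ 2 * C * (2 * C) ^ q * l i := mul_le_mul_of_nonneg_right h7 hli
          _ = _ := by ring
      have : 0 ≤ l i ^ (q + 1 + 1) := by positivity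
      linarith
    · have h5 : 2 * (k : ℝ) ^ 2 * l i ^ k ≤ l i * l i ^ k :=
        mul_le_mul_of_nonneg_right h (by positivity)
      have : 0 ≤ (2 * (k : ℝ) ^ 2) ^ k * l i := by positivity
      rw [pow_succ' (l i)]
      linarith
  have h5 : ∑ i, l i ^ (k + 1) ≤ 2 * (2 * (k : ℝ) ^ 2) ^ k * ∑ v, B v v := by
    have h6 := Finset.sum_le_sum fun i (_ : i ∈ Finset.univ) => h4 i
    rw [← Finset.mul_sum, Finset.sum_add_distrib, ← Finset.sum_div, ← Finset.mul_sum] at h6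
    rw [h3]
    linarith
  have h6 : ∀ i, l i ≤ c := by
    intro i
    have h7 := Finset.single_le_sum (f := fun i => l i ^ (k + 1))
      (fun i _ => pow_nonneg (hl i) _) (Finset.mem_univ i)
    exact le_of_pow_le_pow_left₀ (Nat.succ_ne_zero k) hc0 (h7.trans (h5.trans hc))
  have h7 := sum_mul_pow_apply_mul_le hU hl h6 1 x
  simpa only [pow_one] using h7

/-- A bound for the quadratic form of a positive semidefinite matrix whose support graph
has no self-avoiding walk with `k` steps. -/
theorem quadratic_form_le_of_path [Fintype V] [DecidableEq V] {B : Matrix V V ℝ}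
    (hB : B.PosSemidef) (h0 : ∀ u v, 0 ≤ B u v) (h1 : ∀ v, B v v ≤ 1) (k : ℕ) (hk0 : 1 ≤ k)
    (hk : ∀ s t, pathSum B k ∅ s t = 0) (x : V → ℝ) :
    ∑ u, ∑ v, x u * B u v * x v ≤ (k : ℝ) ^ 2 * ∑ u, x u ^ 2 := by
  obtain ⟨l, U, hl, hU, hUn⟩ := exists_spectral_decomposition hB
  have hP := pow_apply_nonneg h0
  have hmax : ∀ i, l i ≤ (k : ℝ) ^ 2 := by
    rcases isEmpty_or_nonempty V with hV | hV
    · exact fun i => (hV.false i).elim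
    obtain ⟨m, hm⟩ := Finite.exists_max l
    refine fun i => (hm i).trans ?_
    set c := l m with hc
    have hc0 : 0 ≤ c := hl m
    set y : V → ℝ := fun u => |U u m| with hy
    have hyn : ∑ u, y u ^ 2 = 1 := by
      rw [← hUn m]
      exact Finset.sum_congr rfl fun u _ => by simp [hy, sq]
    have hy0 : ∀ u, 0 ≤ y u := fun u => abs_nonneg _
    have hdiag : ∀ j v, (B ^ (j + 1)) v v ≤ c ^ j := by
      intro j v
      have h2 : (B ^ (j + 1)) v v ≤ c ^ j * B v v := by
        have e := hU 1 v v
        rw [pow_one] at e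
        rw [hU, e, Finset.mul_sum]
        refine Finset.sum_le_sum fun i _ => ?_
        have h3 := mul_le_mul_of_nonneg_left (pow_le_pow_left₀ (hl i) (hm i) j)
          (mul_nonneg (mul_self_nonneg (U v i)) (hl i))
        calc U v i * U v i * l i ^ (j + 1) = U v i * U v i * l i * l i ^ j := by ring
          _ ≤ U v i * U v i * l i * l m ^ j := h3
          _ = _ := by rw [hc]; ring
      exact h2.trans (mul_le_of_le_one_right (pow_nonneg hc0 _) (h1 v))
    have h2 : c ^ k ≤ ∑ s, ∑ t, (y s * y t) * loopSum B k s t := by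
      have h3 : c ^ k ≤ ∑ u, ∑ v, U u m * (B ^ k) u v * U v m := by
        rw [sum_mul_pow_apply_mul_eq hU]
        have h4 := Finset.single_le_sum (f := fun i => (∑ u, U u i * U u m) ^ 2 * l i ^ k)
          (fun i _ => mul_nonneg (sq_nonneg _) (pow_nonneg (hl i) _)) (Finset.mem_univ m)
        simpa only [hUn, one_pow, one_mul] using h4
      refine h3.trans (Finset.sum_le_sum fun s _ => Finset.sum_le_sum fun t _ => ?_)
      have h := pow_apply_le_pathSum_add h0 k ∅ s t
      simp only [Finset.coe_empty, Finset.sum_empty, add_zero, hk, zero_add] at h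
      have h4 : U s m * (B ^ k) s t * U t m ≤ (y s * y t) * (B ^ k) s t := by
        rw [hy, ← abs_mul, mul_right_comm]
        exact mul_le_mul_of_nonneg_right (le_abs_self _) (hP _ _ _)
      exact h4.trans (mul_le_mul_of_nonneg_left h (mul_nonneg (hy0 _) (hy0 _)))
    rw [sum_mul_loopSum] at h2
    have h3 : ∀ i ∈ Finset.range k, ∑ j ∈ Finset.range (k - i), ∑ v, (B ^ (j + 1)) v v *
        ∑ s, ∑ t, (y s * y t) * ((B ^ i) s v * (B ^ (k - i - 1 - j)) v t) ≤ k * c ^ (k - 1) := by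
      intro i hi
      have h4 : ∀ j ∈ Finset.range (k - i), ∑ v, (B ^ (j + 1)) v v *
          ∑ s, ∑ t, (y s * y t) * ((B ^ i) s v * (B ^ (k - i - 1 - j)) v t) ≤ c ^ (k - 1) := by
        intro j hj
        rw [Finset.mem_range] at hi hj
        have h5 : ∑ v, ∑ s, ∑ t, (y s * y t) * ((B ^ i) s v * (B ^ (k - i - 1 - j)) v t) =
            ∑ s, ∑ t, y s * (B ^ (k - 1 - j)) s t * y t := by
          rw [Finset.sum_comm]
          refine Finset.sum_congr rfl fun s _ => ?_
          rw [Finset.sum_comm]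
          refine Finset.sum_congr rfl fun t _ => ?_
          have e : k - 1 - j = i + (k - i - 1 - j) := by omega
          rw [e, pow_add, Matrix.mul_apply, Finset.mul_sum, Finset.sum_mul]
          exact Finset.sum_congr rfl fun v _ => by ring
        have h6 := sum_mul_pow_apply_mul_le hU hl hm (k - 1 - j) y
        rw [hyn, mul_one] at h6
        calc _ ≤ ∑ v, c ^ j *
              ∑ s, ∑ t, (y s * y t) * ((B ^ i) s v * (B ^ (k - i - 1 - j)) v t) :=
              Finset.sum_le_sum fun v _ => mul_le_mul_of_nonneg_right (hdiag j v)
                (Finset.sum_nonneg fun s _ => Finset.sum_nonneg fun t _ =>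
                  mul_nonneg (mul_nonneg (hy0 _) (hy0 _)) (mul_nonneg (hP _ _ _) (hP _ _ _)))
          _ ≤ c ^ j * c ^ (k - 1 - j) := by
              rw [← Finset.mul_sum, h5]
              exact mul_le_mul_of_nonneg_left h6 (pow_nonneg hc0 _)
          _ = c ^ (k - 1) := by rw [← pow_add]; congr 1; omega
      refine (Finset.sum_le_sum h4).trans ?_
      rw [Finset.sum_const, Finset.card_range, nsmul_eq_mul]
      refine mul_le_mul_of_nonneg_right ?_ (pow_nonneg hc0 _)
      exact_mod_cast Nat.sub_le k i
    have h4 : c ^ k ≤ (k : ℝ) ^ 2 * c ^ (k - 1) := by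
      refine h2.trans ((Finset.sum_le_sum h3).trans ?_)
      rw [Finset.sum_const, Finset.card_range, nsmul_eq_mul]
      exact le_of_eq (by ring)
    rcases hc0.eq_or_lt with h | h
    · rw [← h]; positivity
    · obtain ⟨q, rfl⟩ : ∃ q, k = q + 1 := ⟨k - 1, by omega⟩
      rw [pow_succ', Nat.add_sub_cancel] at h4
      exact le_of_mul_le_mul_right h4 (pow_pos h q)
  have h7 := sum_mul_pow_apply_mul_le hU hl hmax 1 x
  simpa only [pow_one] using h7

theorem posSemidef_iff_sum_nonneg [Fintype V] {B : Matrix V V ℝ} :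
    B.PosSemidef ↔ (∀ u v, B u v = B v u) ∧ ∀ x : V → ℝ, 0 ≤ ∑ u, ∑ v, x u * B u v * x v := by
  have h : ∀ x : V → ℝ, star x ⬝ᵥ (B.mulVec x) = ∑ u, ∑ v, x u * B u v * x v := by
    intro x
    simp only [dotProduct, Matrix.mulVec, Finset.mul_sum, star_trivial, mul_assoc]
  rw [Matrix.posSemidef_iff_dotProduct_mulVec, Matrix.IsHermitian.ext_iff]
  simp only [h]
  exact Iff.and ⟨fun h u v => h v u, fun h u v => h v u⟩ Iff.rfl

/-- The matrix obtained from `B` by zeroing all rows and columns outside `S`. -/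
noncomputable def restrictMatrix (B : Matrix V V ℝ) (S : Set V) : Matrix V V ℝ :=
  fun u v => S.indicator 1 u * B u v * S.indicator 1 v

theorem restrictMatrix_of_mem {B : Matrix V V ℝ} {S : Set V} {u v : V} (hu : u ∈ S) (hv : v ∈ S) :
    restrictMatrix B S u v = B u v := by
  simp [restrictMatrix, hu, hv]

theorem restrictMatrix_ne_zero {B : Matrix V V ℝ} {S : Set V} {u v : V}
    (h : restrictMatrix B S u v ≠ 0) : u ∈ S ∧ v ∈ S ∧ B u v ≠ 0 := by
  by_cases hu : u ∈ S <;> by_cases hv : v ∈ S <;> simp_all [restrictMatrix]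

theorem restrictMatrix_nonneg {B : Matrix V V ℝ} (hB : ∀ u v, 0 ≤ B u v) (S : Set V) (u v : V) :
    0 ≤ restrictMatrix B S u v :=
  mul_nonneg (mul_nonneg (Set.indicator_nonneg (by simp) _) (hB u v))
    (Set.indicator_nonneg (by simp) _)

theorem restrictMatrix_posSemidef [Fintype V] {B : Matrix V V ℝ} (hB : B.PosSemidef) (S : Set V) :
    (restrictMatrix B S).PosSemidef := by
  rw [posSemidef_iff_sum_nonneg] at hB ⊢
  refine ⟨fun u v => ?_, fun x => ?_⟩
  · simp only [restrictMatrix, hB.1 u v]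
    ring
  · refine (hB.2 fun u => x u * S.indicator 1 u).trans_eq ?_
    refine Finset.sum_congr rfl fun u _ => Finset.sum_congr rfl fun v _ => ?_
    simp only [restrictMatrix]
    ring

theorem mem_of_pathSum_ne_zero [Fintype V] {B : Matrix V V ℝ} (P : V → Prop)
    (hP : ∀ u v, B u v ≠ 0 → P u ∧ P v) {k : ℕ} (hk : k ≠ 0) {L : Set V} {s t : V}
    (h : pathSum B k L s t ≠ 0) : P s := by
  obtain ⟨q, rfl⟩ := Nat.exists_eq_succ_of_ne_zero hk
  by_cases hs : s ∈ L
  · simp [pathSum, hs] at h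
  · simp only [pathSum, hs, not_false_eq_true, if_true] at h
    obtain ⟨u, -, hu⟩ := Finset.exists_ne_zero_of_sum_ne_zero h
    exact (hP s u (left_ne_zero_of_mul hu)).1

theorem CycleFree.false_of_isPath {G : SimpleGraph V} {k : ℕ} (hG : CycleFree G (k + 1))
    (hk : 2 ≤ k) {s t : V} (w : G.Walk s t) (hw : w.IsPath) (hlen : w.length = k)
    (hadj : G.Adj t s) : False := by
  refine hG (.cons hadj w) ((SimpleGraph.Walk.cons_isCycle_iff w hadj).2 ⟨hw, fun h => ?_⟩)
    (by simp [hlen])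
  rw [Sym2.eq_swap] at h
  have := hw.length_eq_one_of_mem_edges h
  omega

theorem CycleFree.mul_pathSum_eq_zero [Fintype V] {G : SimpleGraph V} {k : ℕ}
    (hG : CycleFree G (k + 1)) (hk : 2 ≤ k) {B : Matrix V V ℝ}
    (hB : ∀ u v, B u v ≠ 0 → u = v ∨ G.Adj u v) (s t : V) : B t s * pathSum B k ∅ s t = 0 := by
  by_contra h
  obtain ⟨w, hw, hlen, -⟩ :=
    exists_path_of_pathSum_ne_zero G (fun _ => True) (by simpa using hB) k ∅ s t
      (right_ne_zero_of_mul h)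
  rcases hB t s (left_ne_zero_of_mul h) with rfl | hadj
  · rw [SimpleGraph.Walk.isPath_iff_nil, ← SimpleGraph.Walk.length_eq_zero_iff] at hw
    omega
  · exact hG.false_of_isPath hk w hw hlen hadj

theorem CycleFree.pathSum_eq_zero [Fintype V] {G : SimpleGraph V} {k : ℕ}
    (hG : CycleFree G (k + 2)) (hk : 1 ≤ k) {B : Matrix V V ℝ} (v : V)
    (hB : ∀ a b, B a b ≠ 0 → (a = b ∨ G.Adj a b) ∧ G.Adj v a ∧ G.Adj v b) (s t : V) :
    pathSum B k ∅ s t = 0 := by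
  by_contra h
  obtain ⟨w, hw, hlen, hsup⟩ := exists_path_of_pathSum_ne_zero G (G.Adj v)
    (fun a b hab => ⟨(hB a b hab).1, (hB a b hab).2.2⟩) k ∅ s t h
  have hs : G.Adj v s :=
    mem_of_pathSum_ne_zero (G.Adj v) (fun a b hab => (hB a b hab).2) (by omega) h
  have hall : ∀ x ∈ w.support, G.Adj v x := by
    intro x hx
    rcases (hsup x hx).2 with rfl | h
    · exact hs
    · exact h
  have hv : v ∉ w.support := fun hv => G.loopless.irrefl v (hall v hv)
  exact hG.false_of_isPath (by omega) (.cons hs w) (hw.cons hv) (by simp [hlen])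
    (hall t w.end_mem_support).symm

open Classical in
theorem CycleFree.sum_sq_le [Fintype V] {G : SimpleGraph V} {k : ℕ}
    (hG : CycleFree G (k + 2)) (hk : 1 ≤ k) {B : Matrix V V ℝ} (hB : B.PosSemidef)
    (h0 : ∀ u v, 0 ≤ B u v) (h1 : ∀ v, B v v ≤ 1) (hs : ∀ u v, B u v ≠ 0 → u = v ∨ G.Adj u v)
    (v : V) : ∑ u, (if G.Adj v u then B v u ^ 2 else 0) ≤ (k : ℝ) ^ 2 := by
  set S : Set V := G.neighborSet v with hS
  set c : ℝ := (k : ℝ) ^ 2 with hc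
  have hcpos : 0 < c := by
    have : (0 : ℝ) < k := by exact_mod_cast hk
    positivity
  set z : V → ℝ := fun u => if G.Adj v u then B v u else 0 with hz
  have hzz : ∀ u, (if G.Adj v u then B v u ^ 2 else 0) = z u ^ 2 := by
    intro u
    simp only [hz]
    split_ifs <;> simp
  have hzB : ∀ u, B v u * z u = z u ^ 2 := by
    intro u
    simp only [hz]
    split_ifs
    · ring
    · simp
  simp only [hzz]
  have hq := quadratic_form_le_of_path (restrictMatrix_posSemidef hB S)
    (restrictMatrix_nonneg h0 S) (fun u => by
      by_cases hu : u ∈ S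
      · rw [restrictMatrix_of_mem hu hu]; exact h1 u
      · simp [restrictMatrix, hu]) k hk
    (hG.pathSum_eq_zero hk v fun a b hab => by
      obtain ⟨ha, hb, hab⟩ := restrictMatrix_ne_zero hab
      exact ⟨hs a b hab, ha, hb⟩) z
  have hq2 : ∑ u, ∑ w, z u * restrictMatrix B S u w * z w = ∑ u, ∑ w, z u * B u w * z w := by
    refine Finset.sum_congr rfl fun a _ => Finset.sum_congr rfl fun b _ => ?_
    by_cases ha : a ∈ S
    · by_cases hb : b ∈ S
      · rw [restrictMatrix_of_mem ha hb]
      · have : z b = 0 := if_neg hb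
        simp [this]
    · have : z a = 0 := if_neg ha
      simp [this]
  rw [hq2] at hq
  obtain ⟨hsymm, hpos⟩ := posSemidef_iff_sum_nonneg.1 hB
  have hpos := hpos fun u => z u - c * (if u = v then 1 else 0)
  have hexp : ∑ u, ∑ w, (z u - c * (if u = v then 1 else 0)) * B u w *
      (z w - c * (if w = v then 1 else 0)) =
      ∑ u, ∑ w, z u * B u w * z w - 2 * c * ∑ u, z u ^ 2 + c ^ 2 * B v v := by
    have e : ∀ u w, (z u - c * (if u = v then 1 else 0)) * B u w *
        (z w - c * (if w = v then 1 else 0)) = z u * B u w * z w -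
        (if w = v then c * (z u * B u w) else 0) - (if u = v then c * (B u w * z w) else 0) +
        (if u = v then if w = v then c ^ 2 * B u w else 0 else 0) := by
      intro u w
      split_ifs <;> ring
    simp only [e, Finset.sum_add_distrib, Finset.sum_sub_distrib, Finset.sum_ite_eq',
      Finset.mem_univ, if_true]
    have e2 : ∑ u, ∑ w, (if u = v then c * (B u w * z w) else 0) = c * ∑ u, z u ^ 2 := by
      rw [Finset.sum_comm]
      simp only [Finset.sum_ite_eq', Finset.mem_univ, if_true, hzB, Finset.mul_sum]
    have e3 : ∑ u, ∑ w, (if u = v then if w = v then c ^ 2 * B u w else 0 else 0) =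
        c ^ 2 * B v v := by
      rw [Finset.sum_comm]
      simp
    have e4 : ∑ u, c * (z u * B u v) = c * ∑ u, z u ^ 2 := by
      rw [Finset.mul_sum]
      exact Finset.sum_congr rfl fun u _ => by rw [hsymm u v, mul_comm (z u), hzB]
    rw [e2, e3, e4]
    ring
  rw [hexp] at hpos
  have h3 : c ^ 2 * B v v ≤ c ^ 2 := mul_le_of_le_one_right (by positivity) (h1 v)
  have h4 : c * ∑ u, z u ^ 2 ≤ c * c := by nlinarith
  exact le_of_mul_le_mul_left h4 hcpos

open Classical in
/-- A lower bound for the trace of a nonnegative positive semidefinite matrix which dominates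
the adjacency matrix of a graph without `r`-cycles. -/
theorem CycleFree.sum_adj_le [Fintype V] {G : SimpleGraph V} {r : ℕ} (hr : 3 ≤ r)
    (hG : CycleFree G r) {M : Matrix V V ℝ} (hM : M.PosSemidef) (h0 : ∀ u v, 0 ≤ M u v)
    (h1 : ∀ u v, G.Adj u v → 1 ≤ M u v) (hs : ∀ u v, M u v ≠ 0 → u = v ∨ G.Adj u v)
    {D c : ℝ} (hD : 0 < D) (hc : 0 ≤ c)
    (hcD : 2 * (2 * ((r - 1 : ℕ) : ℝ) ^ 2) ^ (r - 1) *
      (Finset.univ.filter fun v => D < ∑ u, if G.Adj v u then (1 : ℝ) else 0).card ≤ c ^ r) :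
    ∑ u, ∑ v, (if G.Adj u v then (1 : ℝ) else 0) ≤
      (√D * (((r - 2 : ℕ) : ℝ) ^ 2 + 1) + c) * ∑ v, M v v := by
  obtain ⟨hsymm, hpos⟩ := posSemidef_iff_sum_nonneg.1 hM
  set s : V → ℝ := fun v => √(M v v) with hsdef
  have hs0 : ∀ v, 0 ≤ s v := fun v => Real.sqrt_nonneg _
  have hss : ∀ v, s v ^ 2 = M v v := fun v => Real.sq_sqrt (h0 v v)
  have hspos : ∀ u v, G.Adj u v → 0 < s u := by
    intro u v huv
    refine Real.sqrt_pos.2 (lt_of_le_of_ne (h0 u u) fun hu => ?_)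
    have h2 := hpos fun w => (if w = v then 1 else 0) - (M v v + 1) * (if w = u then 1 else 0)
    have e : ∀ a b, ((if a = v then 1 else 0) - (M v v + 1) * (if a = u then 1 else 0)) * M a b *
        ((if b = v then 1 else 0) - (M v v + 1) * (if b = u then 1 else 0)) =
        (if a = v then if b = v then M a b else 0 else 0) -
        (if a = v then if b = u then (M v v + 1) * M a b else 0 else 0) -
        (if a = u then if b = v then (M v v + 1) * M a b else 0 else 0) +
        (if a = u then if b = u then (M v v + 1) ^ 2 * M a b else 0 else 0) := by
      intro a b
      split_ifs <;> ring
    simp only [e, Finset.sum_add_distrib, Finset.sum_sub_distrib] at h2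
    have e2 : ∀ (p q : V) (f : V → V → ℝ),
        ∑ a, ∑ b, (if a = p then if b = q then f a b else 0 else 0) = f p q := by
      intro p q f
      rw [Finset.sum_comm]
      simp
    have e3 := e2 v v M
    simp only [e2, e3, ← hu, hsymm v u] at h2
    have h3 := h1 u v huv
    have h4 := h0 v v
    nlinarith
  set B : Matrix V V ℝ := fun u v => (s u)⁻¹ * M u v * (s v)⁻¹ with hBdef
  have hB : B.PosSemidef := by
    rw [posSemidef_iff_sum_nonneg]
    refine ⟨fun u v => by simp only [hBdef, hsymm u v]; ring, fun x => ?_⟩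
    refine (hpos fun u => x u * (s u)⁻¹).trans_eq ?_
    refine Finset.sum_congr rfl fun u _ => Finset.sum_congr rfl fun v _ => ?_
    simp only [hBdef]
    ring
  have hB0 : ∀ u v, 0 ≤ B u v := fun u v =>
    mul_nonneg (mul_nonneg (inv_nonneg.2 (hs0 u)) (h0 u v)) (inv_nonneg.2 (hs0 v))
  have hB1 : ∀ v, B v v ≤ 1 := by
    intro v
    simp only [hBdef, ← hss]
    rcases (hs0 v).eq_or_lt with h | h
    · simp [← h]
    · exact le_of_eq (by field_simp)
  have hBs : ∀ u v, B u v ≠ 0 → u = v ∨ G.Adj u v := fun u v h =>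
    hs u v (right_ne_zero_of_mul (left_ne_zero_of_mul h))
  have hMB : ∀ u v, G.Adj u v → 1 ≤ s u * B u v * s v := by
    intro u v huv
    have hu := hspos u v huv
    have hv := hspos v u huv.symm
    refine (h1 u v huv).trans_eq ?_
    simp only [hBdef]
    field_simp
  set Y : ℝ := ∑ v, M v v with hY
  set κ : ℝ := ((r - 2 : ℕ) : ℝ) ^ 2 with hκ
  set H : Set V := {v | D < ∑ u, if G.Adj v u then (1 : ℝ) else 0} with hH
  have hsum : ∀ v, ∑ u, (if G.Adj v u then B v u ^ 2 else 0) ≤ κ := by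
    have hG' : CycleFree G (r - 2 + 2) := by rwa [Nat.sub_add_cancel (by omega)]
    exact fun v => hG'.sum_sq_le (by omega) hB hB0 hB1 hBs v
  have hlow : ∑ u, ∑ v, (if u ∉ H ∧ G.Adj u v then (1 : ℝ) else 0) ≤ √D * (κ + 1) / 2 * Y := by
    have hD' : 0 < √D := Real.sqrt_pos.2 hD
    have hpt : ∀ u v, (if u ∉ H ∧ G.Adj u v then (1 : ℝ) else 0) ≤
        √D / 2 * ((if G.Adj v u then B v u ^ 2 else 0) * M v v) +
        (√D)⁻¹ / 2 * (if u ∉ H then (if G.Adj u v then (1 : ℝ) else 0) * M u u else 0) := by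
      intro u v
      by_cases huv : G.Adj u v
      · by_cases hu : u ∈ H
        · simp only [hu, not_true_eq_false, false_and, if_false, mul_zero, add_zero]
          have := mul_nonneg (sq_nonneg (B v u)) (h0 v v)
          simp only [huv.symm, if_true]
          positivity
        · simp only [hu, huv, huv.symm, not_false_eq_true, and_self, if_true, one_mul]
          have h5 := hMB u v huv
          have hBsymm : B v u = B u v := by simp only [hBdef, hsymm u v]; ring
          rw [hBsymm, ← hss, ← hss]
          have h6 : 0 ≤ (√D)⁻¹ / 2 * (√D * (B u v * s v) - s u) ^ 2 := by positivity
          have h7 : (√D)⁻¹ / 2 * (√D * (B u v * s v) - s u) ^ 2 =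
              √D / 2 * (B u v ^ 2 * s v ^ 2) + (√D)⁻¹ / 2 * s u ^ 2 - s u * B u v * s v := by
            field_simp
            ring
          linarith
      · have : ¬ G.Adj v u := fun h => huv h.symm
        simp [huv, this]
    have hsumpt := Finset.sum_le_sum fun u (_ : u ∈ Finset.univ) =>
      Finset.sum_le_sum fun v (_ : v ∈ Finset.univ) => hpt u v
    simp only [Finset.sum_add_distrib, ← Finset.mul_sum] at hsumpt
    have h8 : ∑ u, ∑ v, (if G.Adj v u then B v u ^ 2 else 0) * M v v ≤ κ * Y := by
      rw [Finset.sum_comm, hY, Finset.mul_sum]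
      refine Finset.sum_le_sum fun v _ => ?_
      rw [← Finset.sum_mul]
      exact mul_le_mul_of_nonneg_right (hsum v) (h0 v v)
    have h9 : ∑ u, ∑ v, (if u ∉ H then (if G.Adj u v then (1 : ℝ) else 0) * M u u else 0) ≤
        D * Y := by
      rw [hY, Finset.mul_sum]
      refine Finset.sum_le_sum fun u _ => ?_
      by_cases hu : u ∈ H
      · simp only [hu, not_true_eq_false, if_false, Finset.sum_const_zero]
        exact mul_nonneg hD.le (h0 u u)
      · simp only [hu, not_false_eq_true, if_true, ← Finset.sum_mul]
        exact mul_le_mul_of_nonneg_right (not_lt.1 hu) (h0 u u)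
    calc _ ≤ _ := hsumpt
      _ ≤ √D / 2 * (κ * Y) + (√D)⁻¹ / 2 * (D * Y) := by gcongr
      _ = √D * (κ + 1) / 2 * Y := by
        have : (√D)⁻¹ * D = √D := by
          rw [inv_mul_eq_div, Real.div_sqrt]
        linear_combination Y / 2 * this
  have hhigh : ∑ u, ∑ v, (if u ∈ H ∧ v ∈ H ∧ G.Adj u v then (1 : ℝ) else 0) ≤ c * Y := by
    have hr1 : r - 1 + 1 = r := Nat.sub_add_cancel (by omega)
    have hG' : CycleFree G (r - 1 + 1) := by rwa [hr1]
    have hdiag : ∑ v, restrictMatrix B H v v ≤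
        (Finset.univ.filter fun v => D < ∑ u, if G.Adj v u then (1 : ℝ) else 0).card := by
      rw [← Finset.sum_boole]
      refine Finset.sum_le_sum fun v _ => ?_
      by_cases hv : v ∈ H
      · have hv' : D < ∑ u, if G.Adj v u then (1 : ℝ) else 0 := hv
        rw [restrictMatrix_of_mem hv hv, if_pos hv']
        exact hB1 v
      · have hv' : ¬ D < ∑ u, if G.Adj v u then (1 : ℝ) else 0 := hv
        rw [if_neg hv']
        simp [restrictMatrix, hv]
    have hq := quadratic_form_le_of_trace (restrictMatrix_posSemidef hB H)
      (restrictMatrix_nonneg hB0 H) (fun u => by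
        by_cases hu : u ∈ H
        · rw [restrictMatrix_of_mem hu hu]; exact hB1 u
        · simp [restrictMatrix, hu]) (r - 1) (by omega)
      (hG'.mul_pathSum_eq_zero (by omega) fun a b hab => hBs a b (restrictMatrix_ne_zero hab).2.2)
      hc (by
        rw [hr1]
        exact (mul_le_mul_of_nonneg_left hdiag (by positivity)).trans hcD) s
    simp only [hss] at hq
    refine le_trans (Finset.sum_le_sum fun u _ => Finset.sum_le_sum fun v _ => ?_) hq
    split_ifs with h
    · rw [restrictMatrix_of_mem h.1 h.2.1]
      exact hMB u v h.2.2
    · exact mul_nonneg (mul_nonneg (hs0 u) (restrictMatrix_nonneg hB0 H u v)) (hs0 v)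
  have hlow' : ∑ u, ∑ v, (if v ∉ H ∧ G.Adj u v then (1 : ℝ) else 0) ≤ √D * (κ + 1) / 2 * Y := by
    rw [Finset.sum_comm]
    simpa only [G.adj_comm] using hlow
  have hsplit : ∑ u, ∑ v, (if G.Adj u v then (1 : ℝ) else 0) ≤
      ∑ u, ∑ v, ((if u ∉ H ∧ G.Adj u v then (1 : ℝ) else 0) +
        (if v ∉ H ∧ G.Adj u v then (1 : ℝ) else 0) +
        (if u ∈ H ∧ v ∈ H ∧ G.Adj u v then (1 : ℝ) else 0)) := by
    refine Finset.sum_le_sum fun u _ => Finset.sum_le_sum fun v _ => ?_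
    by_cases huv : G.Adj u v <;> by_cases hu : u ∈ H <;> by_cases hv : v ∈ H <;>
      simp [huv, hu, hv]
  simp only [Finset.sum_add_distrib] at hsplit
  linarith

open Classical in
theorem two_mul_edgeCount [Fintype V] (G : SimpleGraph V) :
    2 * (edgeCount G : ℝ) = ∑ u, ∑ v, if G.Adj u v then (1 : ℝ) else 0 := by
  have h := G.sum_degrees_eq_twice_card_edges
  have h2 : edgeCount G = G.edgeFinset.card := by
    rw [edgeCount, Nat.card_eq_fintype_card, SimpleGraph.edgeFinset_card]
  rw [h2]
  have h3 : (∑ v, (G.degree v : ℝ)) = 2 * (G.edgeFinset.card : ℝ) := by exact_mod_cast h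
  rw [← h3]
  refine Finset.sum_congr rfl fun v _ => ?_
  rw [Finset.sum_boole, ← SimpleGraph.card_neighborFinset_eq_degree,
    SimpleGraph.neighborFinset_eq_filter]

open Classical in
theorem cutSize_eq_sum [Fintype V] (G : SimpleGraph V) (S : Finset V) :
    (cutSize G S : ℝ) = ∑ u, ∑ v, if u ∈ S ∧ v ∉ S ∧ G.Adj u v then (1 : ℝ) else 0 := by
  rw [cutSize, Nat.card_eq_fintype_card, Fintype.card_subtype, ← Fintype.sum_prod_type',
    Finset.sum_boole]

theorem cutSize_le_maxCut [Fintype V] (G : SimpleGraph V) (S : Finset V) :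
    cutSize G S ≤ maxCut G :=
  Finset.le_sup (f := cutSize G) (Finset.mem_powerset.2 (Finset.subset_univ S))

open Classical in
theorem neg_sum_mul_mul_le_surplus_of_sign [Fintype V] (G : SimpleGraph V) (p : V → ℝ)
    (hp : ∀ u, p u = 1 ∨ p u = -1) :
    -(∑ u, ∑ v, (if G.Adj u v then (1 : ℝ) else 0) * p u * p v) / 4 ≤ surplus G := by
  set S : Finset V := Finset.univ.filter fun u => p u = 1 with hS
  have h1 : (cutSize G S : ℝ) ≤ maxCut G := by exact_mod_cast cutSize_le_maxCut G S
  have h2 := two_mul_edgeCount G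
  have h3 := cutSize_eq_sum G S
  have h4 : (cutSize G S : ℝ) = ∑ u, ∑ v, if v ∈ S ∧ u ∉ S ∧ G.Adj u v then (1 : ℝ) else 0 := by
    rw [h3, Finset.sum_comm]
    simp only [G.adj_comm]
  have h5 : ∑ u, ∑ v, (if G.Adj u v then (1 : ℝ) else 0) * p u * p v =
      ∑ u, ∑ v, (if G.Adj u v then (1 : ℝ) else 0) -
      2 * ∑ u, ∑ v, (if u ∈ S ∧ v ∉ S ∧ G.Adj u v then (1 : ℝ) else 0) -
      2 * ∑ u, ∑ v, (if v ∈ S ∧ u ∉ S ∧ G.Adj u v then (1 : ℝ) else 0) := by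
    simp only [Finset.mul_sum, ← Finset.sum_sub_distrib]
    refine Finset.sum_congr rfl fun u _ => Finset.sum_congr rfl fun v _ => ?_
    by_cases huv : G.Adj u v
    · rcases hp u with hu | hu <;> rcases hp v with hv | hv <;>
        norm_num [hS, huv, hu, hv]
    · simp [huv]
  rw [← h3, ← h4, ← h2] at h5
  rw [h5, surplus]
  linarith

open Classical in
theorem neg_sum_mul_mul_le_surplus [Fintype V] (G : SimpleGraph V) (p : V → ℝ)
    (hp : ∀ u, |p u| ≤ 1) :
    -(∑ u, ∑ v, (if G.Adj u v then (1 : ℝ) else 0) * p u * p v) / 4 ≤ surplus G := by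
  suffices h : ∀ (s : Finset V) (p : V → ℝ), (∀ u, |p u| ≤ 1) →
      (∀ u ∉ s, p u = 1 ∨ p u = -1) →
      -(∑ u, ∑ v, (if G.Adj u v then (1 : ℝ) else 0) * p u * p v) / 4 ≤ surplus G from
    h Finset.univ p hp (by simp)
  intro s
  induction s using Finset.induction_on with
  | empty => exact fun p _ hs => neg_sum_mul_mul_le_surplus_of_sign G p (by simpa using hs)
  | insert a s _ ih =>
    intro p hp hs
    have key : ∀ x : ℝ, x = 1 ∨ x = -1 →
        -(∑ u, ∑ v, (if G.Adj u v then (1 : ℝ) else 0) * Function.update p a x u *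
          Function.update p a x v) / 4 ≤ surplus G := by
      intro x hx
      refine ih _ (fun u => ?_) fun u hu => ?_
      · rcases eq_or_ne u a with rfl | hua
        · rcases hx with rfl | rfl <;> simp
        · simpa [hua] using hp u
      · rcases eq_or_ne u a with rfl | hua
        · simpa using hx
        · simpa [hua] using hs u (by simp [hua, hu])
    have hexp : ∑ u, ∑ v, (if G.Adj u v then (1 : ℝ) else 0) * p u * p v =
        (1 + p a) / 2 * (∑ u, ∑ v, (if G.Adj u v then (1 : ℝ) else 0) *
          Function.update p a 1 u * Function.update p a 1 v) +
        (1 - p a) / 2 * (∑ u, ∑ v, (if G.Adj u v then (1 : ℝ) else 0) *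
          Function.update p a (-1) u * Function.update p a (-1) v) := by
      simp only [Finset.mul_sum, ← Finset.sum_add_distrib]
      refine Finset.sum_congr rfl fun u _ => Finset.sum_congr rfl fun v _ => ?_
      by_cases hu : u = a <;> by_cases hv : v = a
      · simp [hu, hv]
      all_goals
        simp only [Function.update_apply, hu, hv, if_true, if_false]
        ring
    have ha := abs_le.1 (hp a)
    have k1 := mul_le_mul_of_nonneg_left (key 1 (Or.inl rfl)) (a := (1 + p a) / 2) (by linarith)
    have k2 := mul_le_mul_of_nonneg_left (key (-1) (Or.inr rfl)) (a := (1 - p a) / 2)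
      (by linarith)
    rw [hexp]
    linarith

theorem surplus_nonneg [Fintype V] (G : SimpleGraph V) : 0 ≤ surplus G := by
  classical
  simpa using neg_sum_mul_mul_le_surplus G 0 (by simp)

open MeasureTheory ProbabilityTheory in
open Classical in
theorem integral_sin_mul_sin_multivariateGaussian [Fintype V] {X : Matrix V V ℝ}
    (hX : X.PosSemidef) (h1 : ∀ v, X v v = 1) (u v : V) :
    ∫ z, Real.sin (z u) * Real.sin (z v) ∂(multivariateGaussian 0 X) =
      (Real.exp 1)⁻¹ * Real.sinh (X u v) := by
  set μ := multivariateGaussian (0 : EuclideanSpace ℝ V) X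
  have hint : ∀ f : EuclideanSpace ℝ V → ℝ, Continuous f → Integrable (fun z => Real.cos (f z)) μ := by
    intro f hf
    refine Integrable.of_bound (by fun_prop) 1 (ae_of_all _ fun z => ?_)
    simpa using Real.abs_cos_le_one (f z)
  have hcos : ∀ t : EuclideanSpace ℝ V, ∫ z, Real.cos (inner ℝ z t) ∂μ =
      Real.exp (-(t.ofLp ⬝ᵥ X.mulVec t.ofLp) / 2) := by
    intro t
    have h := charFun_multivariateGaussian (μ := 0) hX t
    rw [charFun_apply] at h
    have hi : Integrable (fun z : EuclideanSpace ℝ V =>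
        Complex.exp ((inner ℝ z t : ℝ) * Complex.I)) μ := by
      refine Integrable.of_bound (by fun_prop) 1 (ae_of_all _ fun z => ?_)
      rw [Complex.norm_exp_ofReal_mul_I]
    have h2 := congrArg RCLike.re h
    rw [← integral_re hi, inner_zero_right, Complex.ofReal_zero, zero_mul, zero_sub] at h2
    have h3 : Complex.exp (-(((t.ofLp ⬝ᵥ X.mulVec t.ofLp : ℝ) : ℂ) / 2)) =
        ((Real.exp (-(t.ofLp ⬝ᵥ X.mulVec t.ofLp) / 2) : ℝ) : ℂ) := by
      push_cast
      rw [neg_div]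
    rw [h3] at h2
    simpa only [RCLike.re_eq_complex_re, Complex.exp_ofReal_mul_I_re, Complex.ofReal_re] using h2
  have e1 : ∀ z : EuclideanSpace ℝ V, Real.sin (z u) * Real.sin (z v) =
      1 / 2 * Real.cos (inner ℝ z (EuclideanSpace.single u 1 - EuclideanSpace.single v 1)) -
      1 / 2 * Real.cos (inner ℝ z (EuclideanSpace.single u 1 + EuclideanSpace.single v 1)) := by
    intro z
    rw [inner_sub_right, inner_add_right]
    simp only [EuclideanSpace.inner_single_right]
    simp [Real.cos_add, Real.cos_sub]
    ring
  have hsymm : X v u = X u v := (posSemidef_iff_sum_nonneg.1 hX).1 v u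
  simp only [e1]
  rw [integral_sub ((hint _ (by fun_prop)).const_mul _) ((hint _ (by fun_prop)).const_mul _),
    integral_const_mul, integral_const_mul, hcos, hcos, Real.sinh_eq, ← Real.exp_neg]
  simp only [WithLp.ofLp_sub, WithLp.ofLp_add, Matrix.mulVec_sub, Matrix.mulVec_add,
    dotProduct_sub, dotProduct_add, sub_dotProduct, add_dotProduct, EuclideanSpace.single]
  simp [h1, hsymm]
  rw [show (X u v - 1 - (1 - X u v)) / 2 = -1 + X u v by ring,
    show (-1 + -X u v + (-X u v + -1)) / 2 = -1 + -X u v by ring, Real.exp_add, Real.exp_add]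
  ring

open MeasureTheory ProbabilityTheory in
open Classical in
theorem neg_sum_mul_sinh_le_surplus [Fintype V] (G : SimpleGraph V) {X : Matrix V V ℝ}
    (hX : X.PosSemidef) (h1 : ∀ v, X v v = 1) :
    -(∑ u, ∑ v, (if G.Adj u v then (1 : ℝ) else 0) * Real.sinh (X u v)) ≤
      4 * Real.exp 1 * surplus G := by
  set μ := multivariateGaussian (0 : EuclideanSpace ℝ V) X
  have hint : ∀ u v, Integrable (fun z : EuclideanSpace ℝ V =>
      (if G.Adj u v then (1 : ℝ) else 0) * Real.sin (z u) * Real.sin (z v)) μ := by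
    intro u v
    refine Integrable.of_bound (by fun_prop) 1 (ae_of_all _ fun z => ?_)
    rw [Real.norm_eq_abs, abs_mul, abs_mul]
    refine mul_le_one₀ (mul_le_one₀ ?_ (abs_nonneg _) (Real.abs_sin_le_one _)) (abs_nonneg _)
      (Real.abs_sin_le_one _)
    split_ifs <;> simp
  have hint' : Integrable (fun z : EuclideanSpace ℝ V => ∑ u, ∑ v,
      (if G.Adj u v then (1 : ℝ) else 0) * Real.sin (z u) * Real.sin (z v)) μ :=
    integrable_finsetSum _ fun u _ => integrable_finsetSum _ fun v _ => hint u v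
  have hle : ∫ z : EuclideanSpace ℝ V, -(∑ u, ∑ v,
      (if G.Adj u v then (1 : ℝ) else 0) * Real.sin (z u) * Real.sin (z v)) / 4 ∂μ ≤
      ∫ _, surplus G ∂μ :=
    integral_mono (hint'.neg.div_const 4) (integrable_const _) fun z =>
      neg_sum_mul_mul_le_surplus G (fun u => Real.sin (z u)) fun u => Real.abs_sin_le_one _
  have heq : ∫ z : EuclideanSpace ℝ V, (∑ u, ∑ v,
      (if G.Adj u v then (1 : ℝ) else 0) * Real.sin (z u) * Real.sin (z v)) ∂μ =
      (Real.exp 1)⁻¹ * ∑ u, ∑ v, (if G.Adj u v then (1 : ℝ) else 0) * Real.sinh (X u v) := by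
    rw [integral_finsetSum _ fun u _ => integrable_finsetSum _ fun v _ => hint u v, Finset.mul_sum]
    refine Finset.sum_congr rfl fun u _ => ?_
    rw [integral_finsetSum _ fun v _ => hint u v, Finset.mul_sum]
    refine Finset.sum_congr rfl fun v _ => ?_
    simp only [mul_assoc]
    rw [integral_const_mul, integral_sin_mul_sin_multivariateGaussian hX h1]
    ring
  rw [integral_div, integral_neg, heq, integral_const, probReal_univ, one_smul] at hle
  have he := Real.exp_pos 1
  set T := ∑ u, ∑ v, (if G.Adj u v then (1 : ℝ) else 0) * Real.sinh (X u v)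
  have h3 : T = Real.exp 1 * ((Real.exp 1)⁻¹ * T) := by field_simp
  rw [h3]
  nlinarith

theorem sinh_le_two_mul {x : ℝ} (h0 : 0 ≤ x) (h1 : x ≤ 1) : Real.sinh x ≤ 2 * x := by
  have h2 := abs_le.1 (Real.abs_exp_sub_one_sub_id_le (x := x) (by rwa [abs_of_nonneg h0]))
  have h3 := Real.add_one_le_exp (-x)
  rw [Real.sinh_eq]
  nlinarith

theorem two_mul_abs_le_of_posSemidef [Fintype V] {X : Matrix V V ℝ} (hX : X.PosSemidef)
    (u v : V) : 2 * |X u v| ≤ X u u + X v v := by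
  classical
  obtain ⟨hsymm, hpos⟩ := posSemidef_iff_sum_nonneg.1 hX
  have key : ∀ c : ℝ, 0 ≤ X u u + 2 * c * X u v + c ^ 2 * X v v := by
    intro c
    refine (hpos (Pi.single u 1 + Pi.single v c)).trans_eq ?_
    simp only [Pi.add_apply, add_mul, mul_add, Finset.sum_add_distrib, Pi.single_apply, ite_mul,
      mul_ite, one_mul, mul_one, zero_mul, mul_zero, Finset.sum_ite_eq', Finset.mem_univ, if_true]
    rw [hsymm v u]
    ring
  have h1 := key 1
  have h2 := key (-1)
  have h3 : |X u v| ≤ (X u u + X v v) / 2 := abs_le.2 ⟨by linarith, by linarith⟩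
  linarith

open Classical in
theorem exists_weight_neg_sum_le_surplus [Fintype V] (G : SimpleGraph V) {X : Matrix V V ℝ}
    (hX : X.PosSemidef) {c : ℝ} (hc : 0 < c) (hXc : ∀ v, X v v ≤ c) :
    ∃ w : V → V → ℝ, (∀ u v, w u v = w v u) ∧ (∀ u v, 1 ≤ w u v) ∧ (∀ u v, w u v ≤ 2) ∧
      -(∑ u, ∑ v, (if G.Adj u v then w u v else 0) * X u v) ≤
        4 * Real.exp 1 * surplus G * c := by
  obtain ⟨hsymm, hpos⟩ := posSemidef_iff_sum_nonneg.1 hX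
  set Y : Matrix V V ℝ := fun u v => c⁻¹ * X u v + if u = v then 1 - c⁻¹ * X u u else 0 with hY
  have hY1 : ∀ v, Y v v = 1 := fun v => by simp [hY]
  have hYp : Y.PosSemidef := by
    rw [posSemidef_iff_sum_nonneg]
    refine ⟨fun u v => ?_, fun x => ?_⟩
    · rcases eq_or_ne u v with rfl | h
      · rfl
      · simp [hY, h, h.symm, hsymm u v]
    · have e : ∑ u, ∑ v, x u * Y u v * x v =
          c⁻¹ * ∑ u, ∑ v, x u * X u v * x v + ∑ u, (1 - c⁻¹ * X u u) * x u ^ 2 := by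
        have e' : ∀ u v, x u * Y u v * x v = c⁻¹ * (x u * X u v * x v) +
            if u = v then (1 - c⁻¹ * X u u) * x u ^ 2 else 0 := by
          intro u v
          simp only [hY]
          split_ifs with h
          · rw [h]; ring
          · ring
        simp only [e', Finset.sum_add_distrib, ← Finset.mul_sum, Finset.sum_ite_eq,
          Finset.mem_univ, if_true]
      rw [e]
      refine add_nonneg (mul_nonneg (inv_nonneg.2 hc.le) (hpos x))
        (Finset.sum_nonneg fun u _ => mul_nonneg ?_ (sq_nonneg _))
      have := (inv_mul_le_one₀ hc).2 (hXc u)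
      linarith
  have hlow := neg_sum_mul_sinh_le_surplus G hYp hY1
  refine ⟨fun u v => if 0 < X u v then 2 else 1, fun u v => by simp only [hsymm u v],
    fun u v => by dsimp only; split_ifs <;> norm_num,
    fun u v => by dsimp only; split_ifs <;> norm_num, ?_⟩
  have hle : ∑ u, ∑ v, (if G.Adj u v then (1 : ℝ) else 0) * Real.sinh (Y u v) ≤
      ∑ u, ∑ v, c⁻¹ * ((if G.Adj u v then (if 0 < X u v then 2 else 1) else 0) * X u v) := by
    refine Finset.sum_le_sum fun u _ => Finset.sum_le_sum fun v _ => ?_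
    split_ifs with huv hp
    · have hYX : Y u v = c⁻¹ * X u v := by simp [hY, huv.ne]
      have h2 := two_mul_abs_le_of_posSemidef hYp u v
      rw [hY1, hY1] at h2
      have h3 : 0 < Y u v := by rw [hYX]; positivity
      have h4 := sinh_le_two_mul h3.le ((le_abs_self _).trans (by linarith))
      linarith
    · have hYX : Y u v = c⁻¹ * X u v := by simp [hY, huv.ne]
      have h3 : Y u v ≤ 0 := by
        rw [hYX]
        exact mul_nonpos_of_nonneg_of_nonpos (inv_nonneg.2 hc.le) (not_lt.1 hp)
      have h4 := Real.sinh_le_self_iff.2 h3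
      linarith
    · simp
  simp only [← Finset.mul_sum] at hle
  have h5 := mul_le_mul_of_nonneg_right
    ((neg_le_neg hle).trans hlow) hc.le
  refine le_trans (le_of_eq ?_) h5
  field_simp

open Classical in
/-- Semidefinite programming duality for the surplus: there is a nonnegative positive semidefinite
matrix dominating the adjacency matrix, supported on the edges and the diagonal, whose trace is
proportional to the surplus. -/
theorem exists_posSemidef_trace_eq_surplus [Fintype V] [Nonempty V] (G : SimpleGraph V) :
    ∃ M : Matrix V V ℝ, M.PosSemidef ∧ (∀ u v, 0 ≤ M u v) ∧ (∀ u v, G.Adj u v → 1 ≤ M u v) ∧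
      (∀ u v, M u v ≠ 0 → u = v ∨ G.Adj u v) ∧
      ∑ v, M v v = 4 * Real.exp 1 * surplus G := by
  set t : ℝ := 4 * Real.exp 1 * surplus G with ht
  have ht0 : 0 ≤ t := mul_nonneg (by positivity) (surplus_nonneg G)
  set T : Set (V → V → ℝ) :=
    {M | (∀ u v, M u v = M v u) ∧ ∀ x : V → ℝ, 0 ≤ ∑ u, ∑ v, x u * M u v * x v} with hT
  set K : Set (V → V → ℝ) :=
    {M | (∀ u v, 0 ≤ M u v) ∧ (∀ u v, M u v ≤ 2 + t) ∧ (∀ u v, G.Adj u v → 1 ≤ M u v) ∧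
      (∀ u v, u ≠ v → ¬ G.Adj u v → M u v = 0) ∧ ∑ v, M v v = t} with hK
  by_cases hdisj : Disjoint K T
  swap
  · obtain ⟨M, ⟨h1, -, h2, h3, h4⟩, h5⟩ := Set.not_disjoint_iff.1 hdisj
    refine ⟨M, posSemidef_iff_sum_nonneg.2 h5, h1, h2, fun u v huv => ?_, h4⟩
    by_contra! h
    exact huv (h3 u v h.1 h.2)
  exfalso
  have hKconv : Convex ℝ K := by
    intro M hM N hN a b ha hb hab
    obtain ⟨h1, h2, h3, h4, h5⟩ := hM
    obtain ⟨k1, k2, k3, k4, k5⟩ := hN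
    refine ⟨fun u v => ?_, fun u v => ?_, fun u v h => ?_, fun u v h h' => ?_, ?_⟩ <;>
      simp only [Pi.add_apply, Pi.smul_apply, smul_eq_mul]
    · exact add_nonneg (mul_nonneg ha (h1 u v)) (mul_nonneg hb (k1 u v))
    · have := mul_le_mul_of_nonneg_left (h2 u v) ha
      have := mul_le_mul_of_nonneg_left (k2 u v) hb
      have : a * (2 + t) + b * (2 + t) = 2 + t := by rw [← add_mul, hab, one_mul]
      linarith
    · have := mul_le_mul_of_nonneg_left (h3 u v h) ha
      have := mul_le_mul_of_nonneg_left (k3 u v h) hb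
      linarith
    · rw [h4 u v h h', k4 u v h h']
      simp
    · rw [Finset.sum_add_distrib, ← Finset.mul_sum, ← Finset.mul_sum, h5, k5, ← add_mul, hab,
        one_mul]
  have hTconv : Convex ℝ T := by
    intro M hM N hN a b ha hb _
    refine ⟨fun u v => ?_, fun x => ?_⟩
    · simp only [Pi.add_apply, Pi.smul_apply, hM.1 u v, hN.1 u v]
    · have e : ∑ u, ∑ v, x u * (a • M + b • N) u v * x v =
          a * ∑ u, ∑ v, x u * M u v * x v + b * ∑ u, ∑ v, x u * N u v * x v := by
        simp only [Finset.mul_sum, ← Finset.sum_add_distrib, Pi.add_apply, Pi.smul_apply,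
          smul_eq_mul]
        exact Finset.sum_congr rfl fun u _ => Finset.sum_congr rfl fun v _ => by ring
      rw [e]
      exact add_nonneg (mul_nonneg ha (hM.2 x)) (mul_nonneg hb (hN.2 x))
  have hTclosed : IsClosed T := by
    simp only [hT, Set.ofPred_and, Set.ofPred_forall]
    refine IsClosed.inter (isClosed_iInter fun u => isClosed_iInter fun v =>
      isClosed_eq (by fun_prop) (by fun_prop)) (isClosed_iInter fun x =>
      isClosed_le (by fun_prop) (by fun_prop))
  have hKclosed : IsClosed K := by
    simp only [hK, Set.ofPred_and, Set.ofPred_forall]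
    refine IsClosed.inter ?_ (IsClosed.inter ?_ (IsClosed.inter ?_ (IsClosed.inter ?_ ?_)))
    · exact isClosed_iInter fun u => isClosed_iInter fun v =>
        isClosed_le (by fun_prop) (by fun_prop)
    · exact isClosed_iInter fun u => isClosed_iInter fun v =>
        isClosed_le (by fun_prop) (by fun_prop)
    · exact isClosed_iInter fun u => isClosed_iInter fun v => isClosed_iInter fun _ =>
        isClosed_le (by fun_prop) (by fun_prop)
    · exact isClosed_iInter fun u => isClosed_iInter fun v => isClosed_iInter fun _ =>
        isClosed_iInter fun _ => isClosed_eq (by fun_prop) (by fun_prop)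
    · exact isClosed_eq (by fun_prop) (by fun_prop)
  have hKcomp : IsCompact K :=
    (isCompact_Icc (a := (0 : V → V → ℝ)) (b := fun _ _ => 2 + t)).of_isClosed_subset hKclosed
      fun M hM => ⟨fun u v => hM.1 u v, fun u v => hM.2.1 u v⟩
  obtain ⟨f, a, b, hfK, hab, hfT⟩ :=
    geometric_hahn_banach_compact_closed hKconv hKcomp hTconv hTclosed hdisj
  have hb0 : b < 0 := by
    have h0 : (0 : V → V → ℝ) ∈ T := ⟨by simp, by simp⟩
    simpa using hfT 0 h0
  have hfT0 : ∀ M ∈ T, 0 ≤ f M := by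
    intro M hM
    by_contra! hneg
    have hmem : (b / f M) • M ∈ T := by
      have hpos : 0 ≤ b / f M := (div_pos_of_neg_of_neg hb0 hneg).le
      refine ⟨fun u v => by simp only [Pi.smul_apply, hM.1 u v], fun x => ?_⟩
      have e : ∑ u, ∑ v, x u * ((b / f M) • M) u v * x v =
          b / f M * ∑ u, ∑ v, x u * M u v * x v := by
        simp only [Finset.mul_sum, Pi.smul_apply, smul_eq_mul]
        exact Finset.sum_congr rfl fun u _ => Finset.sum_congr rfl fun v _ => by ring
      rw [e]
      exact mul_nonneg hpos (hM.2 x)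
    have h := hfT _ hmem
    rw [map_smul, smul_eq_mul, div_mul_cancel₀ _ hneg.ne] at h
    exact lt_irrefl _ h
  set F : V → V → ℝ := fun u v => f (Pi.single u (Pi.single v 1)) with hF
  have hf : ∀ M : V → V → ℝ, f M = ∑ u, ∑ v, M u v * F u v := by
    intro M
    have e : M = ∑ u, ∑ v, M u v • (Pi.single u (Pi.single v 1) : V → V → ℝ) := by
      ext p q
      simp [Finset.sum_apply, Pi.single_apply, ite_apply]
    conv_lhs => rw [e]
    simp only [map_sum, map_smul, smul_eq_mul, hF]
  set X : Matrix V V ℝ := fun u v => (F u v + F v u) / 2 with hX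
  have hfX : ∀ M : V → V → ℝ, (∀ u v, M u v = M v u) → f M = ∑ u, ∑ v, M u v * X u v := by
    intro M hM
    have e : ∑ u, ∑ v, M u v * F v u = ∑ u, ∑ v, M u v * F u v := by
      rw [Finset.sum_comm]
      exact Finset.sum_congr rfl fun u _ => Finset.sum_congr rfl fun v _ => by rw [hM u v]
    have e2 : ∑ u, ∑ v, M u v * X u v =
        (∑ u, ∑ v, M u v * F u v + ∑ u, ∑ v, M u v * F v u) / 2 := by
      simp only [← Finset.sum_add_distrib, Finset.sum_div, hX]
      exact Finset.sum_congr rfl fun u _ => Finset.sum_congr rfl fun v _ => by ring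
    rw [e2, e, hf]
    ring
  have hXp : X.PosSemidef := by
    rw [posSemidef_iff_sum_nonneg]
    refine ⟨fun u v => by simp only [hX, add_comm], fun x => ?_⟩
    have h := hfT0 (fun u v => x u * x v) ⟨fun u v => mul_comm _ _, fun y => ?_⟩
    · rw [hfX _ fun u v => mul_comm _ _] at h
      refine h.trans_eq ?_
      exact Finset.sum_congr rfl fun u _ => Finset.sum_congr rfl fun v _ => by ring
    · have e : ∑ u, ∑ v, y u * (x u * x v) * y v = (∑ u, y u * x u) ^ 2 := by
        rw [sq, Finset.sum_mul_sum]
        exact Finset.sum_congr rfl fun u _ => Finset.sum_congr rfl fun v _ => by ring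
      rw [e]
      positivity
  obtain ⟨v₀, -, hv₀⟩ := Finset.exists_max_image Finset.univ (fun v => X v v)
    Finset.univ_nonempty
  have hv₀0 : 0 ≤ X v₀ v₀ := hXp.diag_nonneg
  set ε : ℝ := -a / (t + 1) with hε
  have ha0 : a < 0 := hab.trans hb0
  have hε0 : 0 < ε := div_pos (neg_pos.2 ha0) (by linarith)
  have hεt : ε * t ≤ -a := by
    rw [hε, div_mul_eq_mul_div, div_le_iff₀ (by linarith)]
    nlinarith
  obtain ⟨w, hwsymm, hw1, hw2, hw⟩ := exists_weight_neg_sum_le_surplus G hXp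
    (c := X v₀ v₀ + ε) (by linarith) fun v => by
      have := hv₀ v (Finset.mem_univ v)
      linarith
  set M : V → V → ℝ := fun u v => (if G.Adj u v then w u v else 0) +
    if u = v then if v = v₀ then t else 0 else 0 with hM
  have hMK : M ∈ K := by
    refine ⟨fun u v => ?_, fun u v => ?_, fun u v h => ?_, fun u v h h' => ?_, ?_⟩
    · have := hw1 u v
      simp only [hM]
      split_ifs <;> linarith
    · have := hw2 u v
      simp only [hM]
      split_ifs <;> linarith
    · simpa [hM, h, h.ne] using hw1 u v
    · simp [hM, h, h']
    · simp [hM]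
  have h := hfK M hMK
  rw [hfX M fun u v => by
    rcases eq_or_ne u v with rfl | h
    · rfl
    · simp [hM, h, h.symm, G.adj_comm u v, hwsymm u v]] at h
  have e : ∑ u, ∑ v, M u v * X u v =
      ∑ u, ∑ v, (if G.Adj u v then w u v else 0) * X u v + t * X v₀ v₀ := by
    simp only [hM, add_mul, Finset.sum_add_distrib, ite_mul, zero_mul, Finset.sum_ite_eq,
      Finset.sum_ite_eq', Finset.mem_univ, if_true]
  rw [e] at h
  nlinarith

open Classical in
theorem card_filter_lt_le_sqrt_pow [Fintype V] (G : SimpleGraph V) (r : ℕ) {D : ℝ} (hD : 0 < D)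
    (h : (Fintype.card V : ℝ) * ∑ u, ∑ v, (if G.Adj u v then (1 : ℝ) else 0) ≤ D ^ (r + 1)) :
    ((Finset.univ.filter fun v => D < ∑ u, if G.Adj v u then (1 : ℝ) else 0).card : ℝ) ≤
      √D ^ r := by
  set H := Finset.univ.filter fun v => D < ∑ u, if G.Adj v u then (1 : ℝ) else 0 with hH
  have h1 : (H.card : ℝ) ≤ Fintype.card V := by exact_mod_cast H.card_le_univ
  have h2 : H.card * D ≤ ∑ u, ∑ v, (if G.Adj u v then (1 : ℝ) else 0) := by
    rw [← nsmul_eq_mul]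
    refine (H.card_nsmul_le_sum _ _ fun v hv => (Finset.mem_filter.1 hv).2.le).trans ?_
    refine Finset.sum_le_sum_of_subset_of_nonneg (Finset.subset_univ H) fun v _ _ => ?_
    exact Finset.sum_nonneg fun u _ => by split_ifs <;> norm_num
  have h3 : (H.card : ℝ) * (H.card * D) ≤ D ^ (r + 1) :=
    (mul_le_mul h1 h2 (by positivity) (by positivity)).trans h
  have h4 : (H.card : ℝ) ^ 2 ≤ (√D ^ r) ^ 2 := by
    rw [← pow_mul, mul_comm r 2, pow_mul, Real.sq_sqrt hD.le]
    refine le_of_mul_le_mul_right ?_ hD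
    rw [← pow_succ]
    linarith
  exact le_of_sq_le_sq h4 (by positivity)

theorem rpow_mul_rpow_mul_sqrt {n d : ℝ} (hn : 0 < n) (hd : 0 < d) (r : ℕ) :
    n ^ ((r : ℝ) / (r + 1)) * d ^ ((2 * (r : ℝ) + 1) / (2 * r + 2)) *
      √((n ^ 2 * d) ^ ((1 : ℝ) / (r + 1))) = n * d := by
  have hr : (0 : ℝ) < (r : ℝ) + 1 := by positivity
  have h1 : √((n ^ 2 * d) ^ ((1 : ℝ) / (r + 1))) =
      n ^ ((1 : ℝ) / (r + 1)) * d ^ ((1 : ℝ) / (2 * r + 2)) := by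
    rw [Real.sqrt_eq_rpow, ← Real.rpow_mul (by positivity), Real.mul_rpow (by positivity) hd.le,
      ← Real.rpow_natCast n 2, ← Real.rpow_mul hn.le]
    congr 2 <;> (push_cast; field_simp)
  rw [h1, mul_mul_mul_comm, ← Real.rpow_add hn, ← Real.rpow_add hd]
  have e1 : (r : ℝ) / (r + 1) + 1 / (r + 1) = 1 := by field_simp
  have e2 : (2 * (r : ℝ) + 1) / (2 * r + 2) + 1 / (2 * r + 2) = 1 := by
    field_simp
    ring
  rw [e1, e2, Real.rpow_one, Real.rpow_one]

/-- For every odd `r ≥ 5` there is `c_r > 0` such that every graph with `n ≥ 1`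
vertices and average degree `d` containing no cycle of length `r` has surplus at least
`c_r · n^(r/(r+1)) · d^((2r+1)/(2r+2))`. -/
theorem statement15 (r : ℕ) (hr : 5 ≤ r) (hodd : Odd r) :
    ∃ c : ℝ, 0 < c ∧
      ∀ (V : Type) [Fintype V] (G : SimpleGraph V) (d : ℝ),
        1 ≤ Fintype.card V →
        d = 2 * edgeCount G / Fintype.card V →
        CycleFree G r →
        surplus G ≥ c * (Fintype.card V : ℝ) ^ ((r : ℝ) / ((r : ℝ) + 1)) *
          d ^ ((2 * (r : ℝ) + 1) / (2 * (r : ℝ) + 2)) := by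
  set κ : ℝ := ((r - 2 : ℕ) : ℝ) ^ 2 with hκ
  set C : ℝ := 2 * (2 * ((r - 1 : ℕ) : ℝ) ^ 2) ^ (r - 1) with hC
  have hC1 : 1 ≤ C := by
    have h1 : (1 : ℝ) ≤ ((r - 1 : ℕ) : ℝ) := by exact_mod_cast (by omega : 1 ≤ r - 1)
    have h2 : (1 : ℝ) ≤ (2 * ((r - 1 : ℕ) : ℝ) ^ 2) ^ (r - 1) := one_le_pow₀ (by nlinarith)
    linarith
  have hκ0 : 0 ≤ κ := sq_nonneg _
  refine ⟨((κ + 1 + C) * (4 * Real.exp 1))⁻¹, by positivity, fun V _ G d hn hd hG => ?_⟩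
  classical
  have hn0 : (0 : ℝ) < Fintype.card V := by exact_mod_cast hn
  have hd0 : 0 ≤ d := by
    rw [hd]
    positivity
  rcases hd0.eq_or_lt with hd0 | hd0
  · rw [← hd0, Real.zero_rpow (by positivity), mul_zero]
    exact surplus_nonneg G
  have : Nonempty V := Fintype.card_pos_iff.1 hn
  set n : ℝ := (Fintype.card V : ℝ)
  have hsum : ∑ u, ∑ v, (if G.Adj u v then (1 : ℝ) else 0) = n * d := by
    rw [← two_mul_edgeCount, hd]
    field_simp
  obtain ⟨M, hM, h0, h1, hs, htr⟩ := exists_posSemidef_trace_eq_surplus G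
  set D : ℝ := (n ^ 2 * d) ^ ((1 : ℝ) / (r + 1)) with hD
  have hD0 : 0 < D := by positivity
  have hDr : D ^ (r + 1) = n ^ 2 * d := by
    rw [hD, ← Real.rpow_natCast, ← Real.rpow_mul (by positivity)]
    push_cast
    rw [one_div_mul_cancel (by positivity), Real.rpow_one]
  have hH := card_filter_lt_le_sqrt_pow G r hD0 (by
    rw [hsum, hDr]
    exact le_of_eq (by ring))
  have key := hG.sum_adj_le (by omega) hM h0 h1 hs hD0 (c := C * √D) (by positivity) (by
    rw [← hC, mul_pow C]
    exact mul_le_mul (le_self_pow₀ hC1 (by omega : r ≠ 0)) hH (by positivity) (by positivity))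
  rw [hsum, htr, ← rpow_mul_rpow_mul_sqrt hn0 hd0 r, ← hD] at key
  have key2 : n ^ ((r : ℝ) / (r + 1)) * d ^ ((2 * (r : ℝ) + 1) / (2 * r + 2)) ≤
      (κ + 1 + C) * (4 * Real.exp 1) * surplus G :=
    le_of_mul_le_mul_right (by linarith) (Real.sqrt_pos.2 hD0)
  rw [ge_iff_le, mul_assoc, inv_mul_le_iff₀ (by positivity)]
  exact key2

end MaxCutPaper
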